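/- arXiv:1505.05548 — 4 statements merged into one kernel-verified Lean document; each statement's English description precedes it below -/
import Mathlib

section
/- Suppose Γ > 0, λ > 0, μ > 0 and C are real numbers with 0 ≤ C < 2μλ². Suppose f ∈ L¹(ℝ) satisfies |f(ξ)| ≤ C·exp(−μ|ξ|) for all |ξ| ≤ √2·λ, and w ∈ L¹(ℝ) satisfies |w(ξ)| ≤ Γ·exp(−μ|ξ|) for all ξ ∈ ℝ. Then |R[f](ξ)| ≤ exp(−μ|ξ|)·[ (C²/λ²)·((1 + μ|ξ|)/μ)·( 1/(16π) + (1/(2π))·exp(C/(4πλ²μ))·exp((C/(4πλ²))·|ξ|) ) + Γ ] for all ξ ∈ ℝ. -/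
open MeasureTheory Filter

noncomputable section

/-- The Fourier transform `f̂(ξ) = ∫ exp(−i x ξ) f(x) dx` of a real-valued function. -/
def FT (f : ℝ → ℝ) (ξ : ℝ) : ℂ :=
  ∫ x : ℝ, Complex.exp (-(Complex.I * (x:ℂ) * (ξ:ℂ))) * (f x : ℂ)

/-- Convolution of two complex-valued functions on `ℝ`. -/
def conv (f g : ℝ → ℂ) (ξ : ℝ) : ℂ := ∫ η : ℝ, f (ξ - η) * g η

/-- `convIter ψ n = ψ^{*(n+1)}`, the `(n+1)`-fold convolution of `ψ` with itself. -/
def convIter (ψ : ℝ → ℂ) : ℕ → ℝ → ℂ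
  | 0 => ψ
  | n + 1 => conv (convIter ψ n) ψ

/-- `exp₁*[ψ](ξ) = Σ_{n=1}^∞ ψ^{*n}(ξ)/(n!·(2π)^{n−1})`. -/
def exp1star (ψ : ℝ → ℂ) (ξ : ℝ) : ℂ :=
  ∑' n : ℕ, convIter ψ n ξ / ((Nat.factorial (n + 1) : ℂ) * ((2 * Real.pi : ℝ) : ℂ) ^ n)

/-- `exp₂*[ψ](ξ) = Σ_{n=2}^∞ ψ^{*n}(ξ)/(n!·(2π)^{n−1})`. -/
def exp2star (ψ : ℝ → ℂ) (ξ : ℝ) : ℂ :=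
  ∑' n : ℕ, convIter ψ (n + 1) ξ / ((Nat.factorial (n + 2) : ℂ) * ((2 * Real.pi : ℝ) : ℂ) ^ (n + 1))

/-- `W_b[f](ξ) = f(ξ)·b̂(ξ)/(4λ² − ξ²)`. -/
def Wb (lam : ℝ) (b : ℝ → ℝ) (f : ℝ → ℂ) (ξ : ℝ) : ℂ :=
  f ξ * ((b ξ : ℝ) : ℂ) / (((4 * lam ^ 2 - ξ ^ 2 : ℝ)) : ℂ)

/-- `W̃_b[f](ξ) = −iξ·f(ξ)·b̂(ξ)/(4λ² − ξ²)`. -/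
def Wtb (lam : ℝ) (b : ℝ → ℝ) (f : ℝ → ℂ) (ξ : ℝ) : ℂ :=
  -(Complex.I * (ξ:ℂ)) * f ξ * ((b ξ : ℝ) : ℂ) / (((4 * lam ^ 2 - ξ ^ 2 : ℝ)) : ℂ)

/-- The nonlinear operator
`R[f](ξ) = (1/(8π))·(W̃_b[f] * W̃_b[f])(ξ) − 4λ²·exp₂*[W_b[f]](ξ) + w(ξ)`. -/
def Rop (lam : ℝ) (b : ℝ → ℝ) (w : ℝ → ℂ) (f : ℝ → ℂ) (ξ : ℝ) : ℂ :=
  ((1 / (8 * Real.pi) : ℝ) : ℂ) * conv (Wtb lam b f) (Wtb lam b f) ξ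
    - ((4 * lam ^ 2 : ℝ) : ℂ) * exp2star (Wb lam b f) ξ + w ξ

/-- The nonlinear differential operator `S[f](x) = (f′(x))²/4 − 4λ²·(exp(f(x)) − f(x) − 1)`. -/
def Sop (lam : ℝ) (f : ℝ → ℂ) (x : ℝ) : ℂ :=
  (deriv f x) ^ 2 / 4 - ((4 * lam ^ 2 : ℝ) : ℂ) * (Complex.exp (f x) - f x - 1)

/-- The operator `T[f](x) = (1/2π)·∫ exp(i x ξ)·f̂(ξ)/(4λ² − ξ²) dξ`. -/
def OpT (lam : ℝ) (f : ℝ → ℝ) (x : ℝ) : ℂ :=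
  ((1 / (2 * Real.pi) : ℝ) : ℂ) *
    ∫ ξ : ℝ, Complex.exp (Complex.I * (x:ℂ) * (ξ:ℂ)) * FT f ξ / (((4 * lam ^ 2 - ξ ^ 2 : ℝ)) : ℂ)

/-- The band-limited operator `T_b[f](x) = (1/2π)·∫ exp(i x ξ)·f̂(ξ)·b̂(ξ)/(4λ² − ξ²) dξ`,
so that `T_b[f]^(ξ) = f̂(ξ)·b̂(ξ)/(4λ² − ξ²)`. -/
def Tb (lam : ℝ) (b : ℝ → ℝ) (f : ℝ → ℝ) (x : ℝ) : ℂ :=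
  ((1 / (2 * Real.pi) : ℝ) : ℂ) *
    ∫ ξ : ℝ, Complex.exp (Complex.I * (x:ℂ) * (ξ:ℂ)) * FT f ξ * ((b ξ : ℝ) : ℂ) /
      (((4 * lam ^ 2 - ξ ^ 2 : ℝ)) : ℂ)

/-- The Schwarzian derivative `{f, x} = f′′′(x)/f′(x) − (3/2)·(f′′(x)/f′(x))²`. -/
def schwarzian (f : ℝ → ℝ) (x : ℝ) : ℝ :=
  deriv (deriv (deriv f)) x / deriv f x - (3 / 2) * (deriv (deriv f) x / deriv f x) ^ 2

/-- A real-valued function is Schwartz if it agrees with an element of the Schwartz space. -/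
def IsSchwartz (f : ℝ → ℝ) : Prop := ∃ g : SchwartzMap ℝ ℝ, ∀ x, g x = f x

/-- The `L¹(ℝ)` norm `‖f‖₁ = ∫ |f(ξ)| dξ`. -/
def L1norm (f : ℝ → ℂ) : ℝ := ∫ ξ : ℝ, ‖f ξ‖

/-- The modified Bessel function of the second kind,
`K_ν(t) = ∫₀^∞ exp(−t·cosh(s))·cosh(νs) ds`. -/
def besselK (ν t : ℝ) : ℝ :=
  ∫ s in Set.Ioi (0 : ℝ), Real.exp (-t * Real.cosh s) * Real.cosh (ν * s)

/-- Kummer's confluent hypergeometric function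
`M(a,b,z) = Σ_{n=0}^∞ ((a)_n/(b)_n)·zⁿ/n!` with `(a)_n = Γ(a+n)/Γ(a)`. -/
def kummerM (a b z : ℝ) : ℝ :=
  ∑' n : ℕ, (Real.Gamma (a + n) / Real.Gamma a) / (Real.Gamma (b + n) / Real.Gamma b)
      * z ^ n / (Nat.factorial n : ℝ)

/-- The standing hypotheses on the bump function `b̂`: it is smooth, compactly supported,
equal to `1` on `[−λ, λ]`, takes values in `[0, 1]`, and is supported inside
`(−√2·λ, √2·λ)`. -/
def BumpHyp (lam : ℝ) (b : ℝ → ℝ) : Prop :=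
  ContDiff ℝ (⊤ : ℕ∞) b ∧ HasCompactSupport b ∧
    (∀ ξ : ℝ, |ξ| ≤ lam → b ξ = 1) ∧ (∀ ξ : ℝ, 0 ≤ b ξ ∧ b ξ ≤ 1) ∧
    tsupport b ⊆ Set.Ioo (-(Real.sqrt 2 * lam)) (Real.sqrt 2 * lam)


/-- The function equal to `1` on `(L, U]`, decaying at rate `α` to the left of `L` and at rate `β`
to the right of `U`. -/
def expPlateau (α β L U η : ℝ) : ℝ :=
  (Set.Iic L).indicator (fun x ↦ Real.exp (-(α * L)) * Real.exp (α * x)) η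
    + (Set.Ioc L U).indicator (fun _ ↦ (1 : ℝ)) η
    + (Set.Ioi U).indicator (fun x ↦ Real.exp (β * U) * Real.exp (-β * x)) η

theorem expPlateau_of_le {α β L U η : ℝ} (hLU : L ≤ U) (h : η ≤ L) :
    expPlateau α β L U η = Real.exp (α * (η - L)) := by
  have h1 : ¬ L < η := h.not_gt
  have h2 : ¬ U < η := (h.trans hLU).not_gt
  simp only [expPlateau, Set.indicator, Set.mem_Iic, Set.mem_Ioc, Set.mem_Ioi, h, h1, h2,
    if_true, if_false, false_and, add_zero, ← Real.exp_add]
  ring_nf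

theorem expPlateau_of_mem_Ioc {α β L U η : ℝ} (h : η ∈ Set.Ioc L U) :
    expPlateau α β L U η = 1 := by
  have h1 : ¬ η ≤ L := h.1.not_ge
  have h2 : ¬ U < η := h.2.not_gt
  simp only [expPlateau, Set.indicator, Set.mem_Iic, Set.mem_Ioi, h, h1, h2,
    if_true, if_false, add_zero, zero_add]

theorem expPlateau_of_gt {α β L U η : ℝ} (hLU : L ≤ U) (h : U < η) :
    expPlateau α β L U η = Real.exp (-β * (η - U)) := by
  have h1 : ¬ η ≤ L := (hLU.trans_lt h).not_ge
  have h2 : ¬ η ≤ U := h.not_ge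
  simp only [expPlateau, Set.indicator, Set.mem_Iic, Set.mem_Ioc, Set.mem_Ioi, h, h1, h2,
    if_true, if_false, and_false, add_zero, zero_add, ← Real.exp_add]
  ring_nf

theorem integrable_and_integral_expPlateau {α β L U : ℝ} (hα : 0 < α) (hβ : 0 < β) (hLU : L ≤ U) :
    Integrable (expPlateau α β L U) ∧
      ∫ η, expPlateau α β L U η = 1 / α + (U - L) + 1 / β := by
  have i1 : Integrable
      ((Set.Iic L).indicator (fun x ↦ Real.exp (-(α * L)) * Real.exp (α * x))) :=
    IntegrableOn.integrable_indicator ((integrableOn_exp_mul_Iic hα L).const_mul _)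
      measurableSet_Iic
  have i2 : Integrable ((Set.Ioc L U).indicator (fun _ ↦ (1 : ℝ))) :=
    IntegrableOn.integrable_indicator (integrableOn_const (by simp)) measurableSet_Ioc
  have i3 : Integrable
      ((Set.Ioi U).indicator (fun x ↦ Real.exp (β * U) * Real.exp (-β * x))) :=
    IntegrableOn.integrable_indicator
      ((integrableOn_exp_mul_Ioi (neg_lt_zero.mpr hβ) U).const_mul _) measurableSet_Ioi
  refine ⟨(i1.add i2).add i3, ?_⟩
  unfold expPlateau
  rw [integral_add ?_ i3, integral_add i1 i2, integral_indicator measurableSet_Iic,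
    integral_indicator measurableSet_Ioc, integral_indicator measurableSet_Ioi,
    integral_const_mul, integral_const_mul, integral_exp_mul_Iic hα,
    integral_exp_mul_Ioi (neg_lt_zero.mpr hβ)]
  have e1 : Real.exp (-(α * L)) * (Real.exp (α * L) / α) = 1 / α := by
    rw [← mul_div_assoc, ← Real.exp_add]; simp
  have e3 : Real.exp (β * U) * (-Real.exp (-β * U) / -β) = 1 / β := by
    rw [neg_div_neg_eq, ← mul_div_assoc, ← Real.exp_add]; simp
  rw [e1, e3]
  · simp [hLU]
  · exact i1.add i2

theorem exp_mul_exp_le_expPlateau {μ : ℝ} (ξ η : ℝ) :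
    Real.exp (-μ * |ξ - η|) * Real.exp (-μ * |η|) ≤
      Real.exp (-μ * |ξ|) * expPlateau (2 * μ) (2 * μ) (min 0 ξ) (max 0 ξ) η := by
  have hLU : min 0 ξ ≤ max 0 ξ := min_le_max
  rw [← Real.exp_add]
  apply le_of_eq
  rcases le_or_gt η (min 0 ξ) with h | h
  · rw [expPlateau_of_le hLU h, ← Real.exp_add]
    congr 1
    obtain ⟨h0, h1⟩ := le_min_iff.mp h
    rw [abs_of_nonneg (sub_nonneg.mpr h1), abs_of_nonpos h0]
    rcases le_total 0 ξ with hξ | hξ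
    · rw [min_eq_left hξ, abs_of_nonneg hξ]; ring
    · rw [min_eq_right hξ, abs_of_nonpos hξ]; ring
  rcases le_or_gt η (max 0 ξ) with h' | h'
  · rw [expPlateau_of_mem_Ioc ⟨h, h'⟩, mul_one]
    congr 1
    rcases le_total 0 ξ with hξ | hξ
    · rw [min_eq_left hξ] at h
      rw [max_eq_right hξ] at h'
      rw [abs_of_nonneg hξ, abs_of_nonneg (sub_nonneg.mpr h'), abs_of_pos h]; ring
    · rw [min_eq_right hξ] at h
      rw [max_eq_left hξ] at h'
      rw [abs_of_nonpos hξ, abs_of_neg (sub_neg.mpr h), abs_of_nonpos h']; ring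
  · rw [expPlateau_of_gt hLU h', ← Real.exp_add]
    congr 1
    obtain ⟨h0, h1⟩ := max_lt_iff.mp h'
    rw [abs_of_neg (sub_neg.mpr h1), abs_of_pos h0]
    rcases le_total 0 ξ with hξ | hξ
    · rw [max_eq_right hξ, abs_of_nonneg hξ]; ring
    · rw [max_eq_left hξ, abs_of_nonpos hξ]; ring

theorem norm_conv_le_of_le_exp {μ A : ℝ} (hμ : 0 < μ) {f g : ℝ → ℂ}
    (hf : ∀ ξ, ‖f ξ‖ ≤ A * Real.exp (-μ * |ξ|)) (hg : ∀ ξ, ‖g ξ‖ ≤ A * Real.exp (-μ * |ξ|))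
    (ξ : ℝ) :
    ‖conv f g ξ‖ ≤ A ^ 2 / μ * ((1 + μ * |ξ|) * Real.exp (-μ * |ξ|)) := by
  have hμ2 : 0 < 2 * μ := by positivity
  obtain ⟨hi, hv⟩ := integrable_and_integral_expPlateau hμ2 hμ2 (min_le_max : min 0 ξ ≤ max 0 ξ)
  calc ‖conv f g ξ‖
      ≤ ∫ η, A ^ 2 * Real.exp (-μ * |ξ|) *
          expPlateau (2 * μ) (2 * μ) (min 0 ξ) (max 0 ξ) η := by
        refine norm_integral_le_of_norm_le (hi.const_mul _) (Eventually.of_forall fun η ↦ ?_)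
        calc ‖f (ξ - η) * g η‖
            ≤ (A * Real.exp (-μ * |ξ - η|)) * (A * Real.exp (-μ * |η|)) := by
              rw [norm_mul]
              exact mul_le_mul (hf _) (hg _) (norm_nonneg _) ((norm_nonneg _).trans (hf _))
          _ = A ^ 2 * (Real.exp (-μ * |ξ - η|) * Real.exp (-μ * |η|)) := by ring
          _ ≤ A ^ 2 * (Real.exp (-μ * |ξ|) *
                expPlateau (2 * μ) (2 * μ) (min 0 ξ) (max 0 ξ) η) :=
              mul_le_mul_of_nonneg_left (exp_mul_exp_le_expPlateau ξ η) (sq_nonneg A)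
          _ = _ := by ring
    _ = A ^ 2 / μ * ((1 + μ * |ξ|) * Real.exp (-μ * |ξ|)) := by
        rw [integral_const_mul, hv, max_sub_min_eq_abs, sub_zero]
        field_simp
        ring

theorem exp_mul_linear_exp_le_of_nonneg {ν y ξ : ℝ} (hy : 0 < y) (hyν : y ≤ ν) (hξ : 0 ≤ ξ)
    (η : ℝ) :
    ((1 + (ν + y) * |ξ - η|) * Real.exp (-ν * |ξ - η|)) * Real.exp (-(ν + y) * |η|) ≤
      ((1 + (ν + y) * |ξ|) * Real.exp (-ν * |ξ|)) * expPlateau ν y 0 0 η := by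
  have hν : 0 < ν := hy.trans_le hyν
  have hμ : 0 < ν + y := by positivity
  rw [abs_of_nonneg hξ]
  have h1ξ : 1 ≤ 1 + (ν + y) * ξ := by nlinarith
  rcases le_or_gt η 0 with h | h
  · rw [expPlateau_of_le le_rfl h, abs_of_nonpos h, abs_of_nonneg (by linarith : 0 ≤ ξ - η)]
    have key : 1 + (ν + y) * (ξ - η) ≤ (1 + (ν + y) * ξ) * Real.exp ((ν + y) * (-η)) := by
      have h2 := Real.add_one_le_exp ((ν + y) * (-η))
      have h3 : 0 ≤ (ν + y) * (-η) := mul_nonneg hμ.le (by linarith)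
      have h4 : 0 ≤ (ν + y) * ξ := mul_nonneg hμ.le hξ
      nlinarith
    calc _ ≤ ((1 + (ν + y) * ξ) * Real.exp ((ν + y) * (-η)) * Real.exp (-ν * (ξ - η)))
          * Real.exp (-(ν + y) * (-η)) := by gcongr
      _ = _ := by
        rw [mul_assoc, mul_assoc, mul_assoc, ← Real.exp_add, ← Real.exp_add, ← Real.exp_add]
        ring_nf
  rw [expPlateau_of_gt le_rfl h, abs_of_pos h]
  rcases le_or_gt η ξ with h' | h'
  · rw [abs_of_nonneg (by linarith : 0 ≤ ξ - η)]
    calc _ ≤ ((1 + (ν + y) * ξ) * Real.exp (-ν * (ξ - η))) * Real.exp (-(ν + y) * η) := by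
          gcongr; linarith
      _ = _ := by
        rw [mul_assoc, mul_assoc, ← Real.exp_add, ← Real.exp_add]
        ring_nf
  · rw [abs_of_neg (by linarith : ξ - η < 0)]
    have h2 := Real.add_one_le_exp ((ν + y) * (-(ξ - η)))
    calc _ ≤ (Real.exp ((ν + y) * (-(ξ - η))) * Real.exp (-ν * (-(ξ - η))))
          * Real.exp (-(ν + y) * η) := by gcongr; linarith
      _ = Real.exp (-ν * ξ + -y * (η - 0) - (ν - y) * (η - ξ)) := by
        rw [← Real.exp_add, ← Real.exp_add]
        ring_nf
      _ ≤ Real.exp (-ν * ξ + -y * (η - 0)) := by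
        have h3 : 0 ≤ (ν - y) * (η - ξ) := mul_nonneg (by linarith) (by linarith)
        gcongr
        linarith
      _ ≤ (1 + (ν + y) * ξ) * Real.exp (-ν * ξ + -y * (η - 0)) :=
        le_mul_of_one_le_left (Real.exp_pos _).le h1ξ
      _ = _ := by rw [Real.exp_add, mul_assoc]

theorem expPlateau_neg_of_ne {α β η : ℝ} (hη : η ≠ 0) :
    expPlateau α β 0 0 (-η) = expPlateau β α 0 0 η := by
  rcases hη.lt_or_gt with h | h
  · rw [expPlateau_of_gt le_rfl (by linarith), expPlateau_of_le le_rfl h.le]; ring_nf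
  · rw [expPlateau_of_le le_rfl (by linarith), expPlateau_of_gt le_rfl h]; ring_nf

theorem norm_conv_le_of_le_linear_exp {ν y A a : ℝ} (hy : 0 < y) (hyν : y ≤ ν)
    (hA : 0 ≤ A) (ha : 0 ≤ a) {f g : ℝ → ℂ}
    (hf : ∀ ξ, ‖f ξ‖ ≤ A * ((1 + (ν + y) * |ξ|) * Real.exp (-ν * |ξ|)))
    (hg : ∀ ξ, ‖g ξ‖ ≤ a * Real.exp (-(ν + y) * |ξ|)) (ξ : ℝ) :
    ‖conv f g ξ‖ ≤
      A * (a * (1 / y + 1 / ν)) * ((1 + (ν + y) * |ξ|) * Real.exp (-ν * |ξ|)) := by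
  have hν : 0 < ν := hy.trans_le hyν
  have hbound : ∀ η, ‖f (ξ - η) * g η‖ ≤ A * a *
      (((1 + (ν + y) * |ξ - η|) * Real.exp (-ν * |ξ - η|)) * Real.exp (-(ν + y) * |η|)) := by
    intro η
    rw [norm_mul]
    calc _ ≤ (A * ((1 + (ν + y) * |ξ - η|) * Real.exp (-ν * |ξ - η|))) *
          (a * Real.exp (-(ν + y) * |η|)) :=
          mul_le_mul (hf _) (hg _) (norm_nonneg _) ((norm_nonneg _).trans (hf _))
      _ = _ := by ring
  have main : ∀ α β : ℝ, 0 < α → 0 < β → 1 / α + 1 / β = 1 / y + 1 / ν →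
      (∀ᵐ η : ℝ, ((1 + (ν + y) * |ξ - η|) * Real.exp (-ν * |ξ - η|)) *
        Real.exp (-(ν + y) * |η|) ≤
          ((1 + (ν + y) * |ξ|) * Real.exp (-ν * |ξ|)) * expPlateau α β 0 0 η) →
      ‖conv f g ξ‖ ≤
        A * (a * (1 / y + 1 / ν)) * ((1 + (ν + y) * |ξ|) * Real.exp (-ν * |ξ|)) := by
    intro α β hα hβ hαβ h
    obtain ⟨hi, hv⟩ := integrable_and_integral_expPlateau hα hβ (le_refl (0 : ℝ))
    calc ‖conv f g ξ‖ ≤ ∫ η, A * a * (((1 + (ν + y) * |ξ|) * Real.exp (-ν * |ξ|)) *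
          expPlateau α β 0 0 η) := by
          refine norm_integral_le_of_norm_le ((hi.const_mul _).const_mul _) ?_
          filter_upwards [h] with η hη
          exact (hbound η).trans (mul_le_mul_of_nonneg_left hη (mul_nonneg hA ha))
      _ = _ := by
          rw [integral_const_mul, integral_const_mul, hv, ← hαβ]
          ring
  rcases le_total 0 ξ with hξ | hξ
  · exact main ν y hν hy (add_comm _ _) (Eventually.of_forall fun η ↦
      exp_mul_linear_exp_le_of_nonneg hy hyν hξ η)
  · refine main y ν hy hν rfl ?_
    filter_upwards [Measure.ae_ne volume (0 : ℝ)] with η hη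
    have := exp_mul_linear_exp_le_of_nonneg hy hyν (neg_nonneg.mpr hξ) (-η)
    rwa [expPlateau_neg_of_ne hη, abs_neg, abs_neg, neg_sub_neg, abs_sub_comm] at this

theorem norm_convIter_succ_le {ν y a : ℝ} (hy : 0 < y) (hyν : y ≤ ν) (ha : 0 ≤ a)
    {ψ : ℝ → ℂ} (hψ : ∀ ξ, ‖ψ ξ‖ ≤ a * Real.exp (-(ν + y) * |ξ|)) (n : ℕ) (ξ : ℝ) :
    ‖convIter ψ (n + 1) ξ‖ ≤ a ^ 2 / (ν + y) * (a * (1 / y + 1 / ν)) ^ n *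
      ((1 + (ν + y) * |ξ|) * Real.exp (-ν * |ξ|)) := by
  have hν : 0 < ν := hy.trans_le hyν
  induction n generalizing ξ with
  | zero =>
    refine (norm_conv_le_of_le_exp (by positivity) hψ hψ ξ).trans ?_
    rw [pow_zero, mul_one]
    gcongr
    linarith
  | succ n ih =>
    refine (norm_conv_le_of_le_linear_exp hy hyν (by positivity) ha ih hψ ξ).trans_eq ?_
    rw [pow_succ]
    ring

theorem two_mul_three_pow_le_factorial (n : ℕ) : 2 * 3 ^ n ≤ (n + 2).factorial := by
  induction n with
  | zero => decide
  | succ n ih =>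
    rw [pow_succ, show n + 1 + 2 = (n + 2) + 1 by ring, Nat.factorial_succ]
    nlinarith

theorem norm_exp2star_le {ν y a : ℝ} (hy : 0 < y) (hyν : y ≤ ν) (ha : 0 ≤ a)
    (hay : a * (1 / y + 1 / ν) ≤ 3 * Real.pi)
    {ψ : ℝ → ℂ} (hψ : ∀ ξ, ‖ψ ξ‖ ≤ a * Real.exp (-(ν + y) * |ξ|)) (ξ : ℝ) :
    ‖exp2star ψ ξ‖ ≤ a ^ 2 / (2 * Real.pi * (ν + y)) *
      ((1 + (ν + y) * |ξ|) * Real.exp (-ν * |ξ|)) := by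
  have hν : 0 < ν := hy.trans_le hyν
  have hπ := Real.pi_pos
  set Q := (1 + (ν + y) * |ξ|) * Real.exp (-ν * |ξ|)
  have hQ0 : 0 ≤ Q := by positivity
  have hsum := hasSum_geometric_two.mul_left (a ^ 2 / (4 * Real.pi * (ν + y)) * Q)
  refine (tsum_of_norm_bounded hsum fun n ↦ ?_).trans_eq (by field_simp; ring)
  have hfac : (2 * 3 ^ n : ℝ) ≤ ((n + 2).factorial : ℝ) := by
    exact_mod_cast two_mul_three_pow_le_factorial n
  have hden : ‖((n + 2).factorial : ℂ) * ((2 * Real.pi : ℝ) : ℂ) ^ (n + 1)‖ =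
      ((n + 2).factorial : ℝ) * (2 * Real.pi) ^ (n + 1) := by
    rw [norm_mul, norm_pow, Complex.norm_natCast, Complex.norm_real, Real.norm_of_nonneg]
    positivity
  rw [norm_div, hden]
  calc _ ≤ (a ^ 2 / (ν + y) * (3 * Real.pi) ^ n * Q) / (2 * 3 ^ n * (2 * Real.pi) ^ (n + 1)) := by
        refine div_le_div₀ (by positivity) ?_ (by positivity) (by gcongr)
        refine (norm_convIter_succ_le hy hyν ha hψ n ξ).trans ?_
        gcongr
    _ = _ := by
        simp only [mul_pow, pow_succ, div_pow, one_pow]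
        field_simp
        norm_num

theorem four_mul_sq_sub_sq_ge {lam ξ : ℝ} (h : |ξ| ≤ Real.sqrt 2 * lam) :
    2 * lam ^ 2 ≤ 4 * lam ^ 2 - ξ ^ 2 := by
  have h1 : |ξ| ^ 2 ≤ (Real.sqrt 2 * lam) ^ 2 := by gcongr
  rw [sq_abs, mul_pow, Real.sq_sqrt (by norm_num)] at h1
  linarith

theorem BumpHyp.eq_zero {lam : ℝ} {b : ℝ → ℝ} (hb : BumpHyp lam b) {ξ : ℝ}
    (h : ¬ |ξ| ≤ Real.sqrt 2 * lam) : b ξ = 0 := by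
  by_contra hne
  have := hb.2.2.2.2 (subset_tsupport b hne)
  exact h (abs_le.mpr ⟨this.1.le, this.2.le⟩)

theorem norm_Wb_le {lam μ C : ℝ} (hlam : 0 < lam) (hC0 : 0 ≤ C) {b : ℝ → ℝ} (hb : BumpHyp lam b)
    {f : ℝ → ℂ}
    (hfbd : ∀ ξ : ℝ, |ξ| ≤ Real.sqrt 2 * lam → ‖f ξ‖ ≤ C * Real.exp (-μ * |ξ|)) (ξ : ℝ) :
    ‖Wb lam b f ξ‖ ≤ C / (2 * lam ^ 2) * Real.exp (-μ * |ξ|) := by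
  by_cases h : |ξ| ≤ Real.sqrt 2 * lam
  · have hd := four_mul_sq_sub_sq_ge h
    have hd0 : 0 < 4 * lam ^ 2 - ξ ^ 2 := lt_of_lt_of_le (by positivity) hd
    obtain ⟨hb0, hb1⟩ := hb.2.2.2.1 ξ
    rw [Wb, norm_div, norm_mul, Complex.norm_real, Complex.norm_real, Real.norm_of_nonneg hb0,
      Real.norm_of_nonneg hd0.le]
    calc _ ≤ (C * Real.exp (-μ * |ξ|) * 1) / (2 * lam ^ 2) := by
          have := hfbd ξ h
          gcongr
      _ = _ := by ring
  · rw [Wb, hb.eq_zero h]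
    simp only [Complex.ofReal_zero, mul_zero, zero_div, norm_zero]
    positivity

theorem norm_Wtb_le {lam μ C : ℝ} (hlam : 0 < lam) (hC0 : 0 ≤ C) {b : ℝ → ℝ} (hb : BumpHyp lam b)
    {f : ℝ → ℂ}
    (hfbd : ∀ ξ : ℝ, |ξ| ≤ Real.sqrt 2 * lam → ‖f ξ‖ ≤ C * Real.exp (-μ * |ξ|)) (ξ : ℝ) :
    ‖Wtb lam b f ξ‖ ≤ Real.sqrt 2 * lam * (C / (2 * lam ^ 2)) * Real.exp (-μ * |ξ|) := by
  have hW : Wtb lam b f ξ = -(Complex.I * (ξ : ℂ)) * Wb lam b f ξ := by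
    rw [Wtb, Wb]; ring
  have hn : ‖Wtb lam b f ξ‖ = |ξ| * ‖Wb lam b f ξ‖ := by
    rw [hW, norm_mul, norm_neg, norm_mul, Complex.norm_I, one_mul, Complex.norm_real,
      Real.norm_eq_abs]
  by_cases h : |ξ| ≤ Real.sqrt 2 * lam
  · rw [hn, mul_assoc]
    exact mul_le_mul h (norm_Wb_le hlam hC0 hb hfbd ξ) (norm_nonneg _) (by positivity)
  · rw [Wtb, hb.eq_zero h]
    simp only [Complex.ofReal_zero, mul_zero, zero_div, norm_zero]
    positivity

theorem norm_exp2star_Wb_le {lam μ C : ℝ} (hlam : 0 < lam) (hμ : 0 < μ) (hC0 : 0 ≤ C)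
    (hC : C < 2 * μ * lam ^ 2) {b : ℝ → ℝ} (hb : BumpHyp lam b) {f : ℝ → ℂ}
    (hfbd : ∀ ξ : ℝ, |ξ| ≤ Real.sqrt 2 * lam → ‖f ξ‖ ≤ C * Real.exp (-μ * |ξ|)) (ξ : ℝ) :
    ‖exp2star (Wb lam b f) ξ‖ ≤ (C / (2 * lam ^ 2)) ^ 2 / (2 * Real.pi * μ) *
      ((1 + μ * |ξ|) * (Real.exp (-μ * |ξ|) * Real.exp (C / (4 * Real.pi * lam ^ 2) * |ξ|))) := by
  have hπ := Real.pi_gt_three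
  have hW := norm_Wb_le hlam hC0 hb hfbd
  set a := C / (2 * lam ^ 2) with ha
  have ha0 : 0 ≤ a := by positivity
  have haμ : a < μ := by
    rw [ha, div_lt_iff₀ (by positivity)]; linarith
  have general : ∀ y : ℝ, 0 < y → y ≤ μ / 6 → a ≤ y * (2 * Real.pi) →
      ‖exp2star (Wb lam b f) ξ‖ ≤ a ^ 2 / (2 * Real.pi * μ) *
        ((1 + μ * |ξ|) * Real.exp (-(μ - y) * |ξ|)) := by
    intro y hy hyμ hay
    have hν : 0 < μ - y := by linarith
    have h := norm_exp2star_le (ν := μ - y) hy (by linarith) ha0 ?_ (by simpa using hW) ξ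
    · simpa using h
    · have h1 : a * (1 / y) ≤ 2 * Real.pi := by
        rw [mul_one_div, div_le_iff₀ hy]; linarith
      have h2 : a * (1 / (μ - y)) ≤ Real.pi := by
        rw [mul_one_div, div_le_iff₀ hν]; nlinarith
      linarith
  rcases hC0.eq_or_lt with h0 | hCpos
  · have ha' : a = 0 := by rw [ha, ← h0, zero_div]
    have h := general (μ / 6) (by positivity) le_rfl (by rw [ha']; positivity)
    rw [ha'] at h ⊢
    simpa using h
  · have hapos : 0 < a := by positivity
    have hy : C / (4 * Real.pi * lam ^ 2) = a / (2 * Real.pi) := by rw [ha]; field_simp; norm_num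
    have h := general (a / (2 * Real.pi)) (by positivity)
      (by rw [div_le_iff₀ (by positivity)]; nlinarith)
      (by rw [div_mul_cancel₀ _ (by positivity)])
    rw [hy, ← Real.exp_add]
    convert h using 4
    ring

/-- Theorem `spectrum:STheorem`: the key pointwise estimate for the
operator `R`. -/
theorem stmt_7
    (Γ lam μ C : ℝ) (hΓ : 0 < Γ) (hlam : 0 < lam) (hμ : 0 < μ)
    (hC0 : 0 ≤ C) (hC : C < 2 * μ * lam ^ 2)
    (b : ℝ → ℝ) (hb : BumpHyp lam b)
    (f : ℝ → ℂ) (hf : Integrable f)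
    (hfbd : ∀ ξ : ℝ, |ξ| ≤ Real.sqrt 2 * lam → ‖f ξ‖ ≤ C * Real.exp (-μ * |ξ|))
    (w : ℝ → ℂ) (hw : Integrable w)
    (hwbd : ∀ ξ : ℝ, ‖w ξ‖ ≤ Γ * Real.exp (-μ * |ξ|)) :
    ∀ ξ : ℝ, ‖Rop lam b w f ξ‖ ≤
      Real.exp (-μ * |ξ|) *
        ((C ^ 2 / lam ^ 2) * ((1 + μ * |ξ|) / μ) *
          (1 / (16 * Real.pi) +
            (1 / (2 * Real.pi)) * Real.exp (C / (4 * Real.pi * lam ^ 2 * μ)) *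
              Real.exp ((C / (4 * Real.pi * lam ^ 2)) * |ξ|))
          + Γ) := by
  intro ξ
  have hπ := Real.pi_pos
  have h1 := norm_conv_le_of_le_exp hμ (norm_Wtb_le hlam hC0 hb hfbd)
    (norm_Wtb_le hlam hC0 hb hfbd) ξ
  have h2 := norm_exp2star_Wb_le hlam hμ hC0 hC hb hfbd ξ
  have h3 := hwbd ξ
  set E := Real.exp (-μ * |ξ|)
  set G := Real.exp (C / (4 * Real.pi * lam ^ 2) * |ξ|)
  have hG : 0 < G := Real.exp_pos _
  have hE : 0 < E := Real.exp_pos _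
  have hexp : 1 ≤ Real.exp (C / (4 * Real.pi * lam ^ 2 * μ)) :=
    Real.one_le_exp (by positivity)
  calc ‖Rop lam b w f ξ‖
      ≤ 1 / (8 * Real.pi) * ‖conv (Wtb lam b f) (Wtb lam b f) ξ‖
          + 4 * lam ^ 2 * ‖exp2star (Wb lam b f) ξ‖ + ‖w ξ‖ := by
        refine (norm_add_le _ _).trans ?_
        gcongr
        refine (norm_sub_le _ _).trans_eq ?_
        rw [norm_mul, norm_mul, Complex.norm_real, Complex.norm_real,
          Real.norm_of_nonneg (by positivity), Real.norm_of_nonneg (by positivity)]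
    _ ≤ 1 / (8 * Real.pi) * ((Real.sqrt 2 * lam * (C / (2 * lam ^ 2))) ^ 2 / μ *
            ((1 + μ * |ξ|) * E))
          + 4 * lam ^ 2 * ((C / (2 * lam ^ 2)) ^ 2 / (2 * Real.pi * μ) *
            ((1 + μ * |ξ|) * (E * G))) + Γ * E := by gcongr
    _ = E * ((C ^ 2 / lam ^ 2) * ((1 + μ * |ξ|) / μ) *
          (1 / (16 * Real.pi) + (1 / (2 * Real.pi)) * 1 * G) + Γ) := by
        rw [mul_pow, mul_pow, Real.sq_sqrt (by norm_num)]
        field_simp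
        ring
    _ ≤ _ := by gcongr

end
end

section
/- If f : ℝ → ℂ belongs to the Schwartz space S(ℝ), then the functions x ↦ exp(f(x)) − 1 and x ↦ exp(f(x)) − f(x) − 1 also belong to S(ℝ). -/
open MeasureTheory Filter

noncomputable section

/-- Postcomposing a bounded function of temperate growth with a smooth function on a
finite-dimensional space gives a function of temperate growth. -/
theorem ContDiff.hasTemperateGrowth_comp_of_bounded {E F G : Type*}
    [NormedAddCommGroup E] [NormedSpace ℝ E]
    [NormedAddCommGroup F] [NormedSpace ℝ F] [FiniteDimensional ℝ F]
    [NormedAddCommGroup G] [NormedSpace ℝ G] {g : F → G} {f : E → F}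
    (hg : ContDiff ℝ (⊤ : ℕ∞) g) (hf : f.HasTemperateGrowth) {M : ℝ} (hM : ∀ x, ‖f x‖ ≤ M) :
    (g ∘ f).HasTemperateGrowth := by
  have hproper : ProperSpace F := FiniteDimensional.proper ℝ F
  have hsub : Set.range f ⊆ Metric.closedBall 0 (max M 1) := by
    rintro _ ⟨x, rfl⟩
    simpa using Or.inl (hM x)
  have hunique : UniqueDiffOn ℝ (Metric.closedBall (0 : F) (max M 1)) := by
    refine uniqueDiffOn_convex (convex_closedBall _ _) ⟨0, ?_⟩
    exact Metric.ball_subset_interior_closedBall (Metric.mem_ball_self (by positivity))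
  refine hf.comp' hsub hunique hg.contDiffOn fun N ↦ ?_
  have hbound (n : ℕ) : ∃ C, ∀ x ∈ Metric.closedBall (0 : F) (max M 1),
      ‖iteratedFDerivWithin ℝ n g (Metric.closedBall 0 (max M 1)) x‖ ≤ C :=
    (isCompact_closedBall _ _).exists_bound_of_continuousOn
      (hg.contDiffOn.continuousOn_iteratedFDerivWithin (mod_cast le_top) hunique)
  choose C hC using hbound
  refine ⟨0, ∑ n ∈ Finset.range (N + 1), |C n|, by positivity, fun n hn x hx ↦ ?_⟩
  calc _ ≤ |C n| := (hC n x hx).trans (le_abs_self _)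
    _ ≤ ∑ n ∈ Finset.range (N + 1), |C n| :=
      Finset.single_le_sum (f := fun n ↦ |C n|) (fun _ _ ↦ abs_nonneg _)
        (Finset.mem_range.2 (by omega))
    _ = _ := by simp

/-- Postcomposing a Schwartz function with an entire function that vanishes at the origin gives a
Schwartz function. -/
theorem Differentiable.exists_schwartzMap_comp {E : Type*} [NormedAddCommGroup E]
    [NormedSpace ℝ E] {g : ℂ → ℂ} (hg : Differentiable ℂ g) (hg0 : g 0 = 0)
    (f : SchwartzMap E ℂ) : ∃ h : SchwartzMap E ℂ, ∀ x, h x = g (f x) := by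
  have hslope : Differentiable ℂ (dslope g 0) := by
    rw [← differentiableOn_univ]
    exact (Complex.differentiableOn_dslope univ_mem).2 hg.differentiableOn
  have hgrowth : (dslope g 0 ∘ f).HasTemperateGrowth :=
    (hslope.contDiff.restrict_scalars ℝ).hasTemperateGrowth_comp_of_bounded f.hasTemperateGrowth
      (f.norm_le_seminorm ℝ)
  refine ⟨SchwartzMap.smulLeftCLM ℂ (dslope g 0 ∘ f) f, fun x ↦ ?_⟩
  rw [SchwartzMap.smulLeftCLM_apply_apply hgrowth, smul_eq_mul, mul_comm]
  simpa [hg0] using sub_smul_dslope g 0 (f x)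

/-- Theorem `preliminaries:convolution:theorem1`: if `f` is Schwartz
then so are `exp(f) − 1` and `exp(f) − f − 1`. -/
theorem stmt_11 (f : SchwartzMap ℝ ℂ) :
    (∃ g : SchwartzMap ℝ ℂ, ∀ x : ℝ, g x = Complex.exp (f x) - 1) ∧
    (∃ h : SchwartzMap ℝ ℂ, ∀ x : ℝ, h x = Complex.exp (f x) - f x - 1) := by
  exact ⟨Differentiable.exists_schwartzMap_comp (g := fun z ↦ Complex.exp z - 1)
      (by fun_prop) (by simp) f,
    Differentiable.exists_schwartzMap_comp (g := fun z ↦ Complex.exp z - z - 1)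
      (by fun_prop) (by simp) f⟩

end
end

section
/- If ψ belongs to the Schwartz space S(ℝ), then the L¹ functions exp₁*[ψ] and exp₂*[ψ] agree almost everywhere with elements of S(ℝ). -/
open MeasureTheory Filter

noncomputable section

open scoped ContDiff FourierTransform SchwartzMap

/-- The composition of a Schwartz function with a smooth function defined on the whole (proper)
codomain has temperate growth. -/
theorem SchwartzMap.hasTemperateGrowth_comp {E F G : Type*}
    [NormedAddCommGroup E] [NormedSpace ℝ E] [NormedAddCommGroup F] [NormedSpace ℝ F]
    [ProperSpace F] [NormedAddCommGroup G] [NormedSpace ℝ G]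
    {g : F → G} (hg : ContDiff ℝ ∞ g) (u : 𝓢(E, F)) :
    Function.HasTemperateGrowth (g ∘ u) := by
  set R : ℝ := SchwartzMap.seminorm ℝ 0 0 u + 1 with hR
  have hopen : IsOpen (Metric.ball (0 : F) R) := Metric.isOpen_ball
  refine Function.HasTemperateGrowth.comp' (t := Metric.ball 0 R) ?_ hopen.uniqueDiffOn
    hg.contDiffOn ?_ u.hasTemperateGrowth
  · rintro _ ⟨x, rfl⟩
    have := SchwartzMap.norm_le_seminorm ℝ u x
    rw [mem_ball_zero_iff]
    linarith
  · have bound (n : ℕ) : ∃ C : ℝ, ∀ x ∈ Metric.closedBall (0 : F) R,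
        ‖iteratedFDeriv ℝ n g x‖ ≤ C :=
      (isCompact_closedBall (0 : F) R).exists_bound_of_continuousOn
        (hg.continuous_iteratedFDeriv (mod_cast le_top)).continuousOn
    choose C hC using bound
    refine fun N ↦ ⟨0, ∑ n ∈ Finset.range (N + 1), |C n|, by positivity, fun n hn x hx ↦ ?_⟩
    rw [iteratedFDerivWithin_of_isOpen n hopen hx, pow_zero, mul_one]
    calc ‖iteratedFDeriv ℝ n g x‖ ≤ |C n| :=
          (hC n x (Metric.ball_subset_closedBall hx)).trans (le_abs_self _)
      _ ≤ _ := Finset.single_le_sum (f := fun n ↦ |C n|) (fun _ _ ↦ abs_nonneg _)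
          (Finset.mem_range.2 (by lia))

theorem Complex.contDiff_dslope_exp_zero : ContDiff ℝ ∞ (dslope Complex.exp 0) := by
  have h : Differentiable ℂ (dslope Complex.exp 0) := by
    rw [← differentiableOn_univ, Complex.differentiableOn_dslope Filter.univ_mem]
    exact Complex.differentiable_exp.differentiableOn
  exact (h.contDiff (n := ∞)).restrict_scalars ℝ

theorem Complex.hasSum_exp_sub_one (z : ℂ) :
    HasSum (fun n : ℕ ↦ z ^ (n + 1) / (Nat.factorial (n + 1) : ℂ)) (Complex.exp z - 1) := by
  have h := NormedSpace.expSeries_div_hasSum_exp z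
  rw [← Complex.exp_eq_exp_ℂ, ← hasSum_nat_add_iff' 1] at h
  simpa using h

/-- Composing a Schwartz function with `z ↦ exp z - 1` gives a Schwartz function. -/
theorem SchwartzMap.exists_eq_exp_sub_one {E : Type*} [NormedAddCommGroup E] [NormedSpace ℝ E]
    (u : 𝓢(E, ℂ)) : ∃ v : 𝓢(E, ℂ), ∀ x, v x = Complex.exp (u x) - 1 := by
  have ht := SchwartzMap.hasTemperateGrowth_comp Complex.contDiff_dslope_exp_zero u
  refine ⟨SchwartzMap.smulLeftCLM ℂ (dslope Complex.exp 0 ∘ u) u, fun x ↦ ?_⟩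
  have := sub_smul_dslope Complex.exp 0 (u x)
  rw [SchwartzMap.smulLeftCLM_apply_apply ht]
  simpa [mul_comm] using this

/-- The iterated convolutions of a Schwartz function, as Schwartz functions. -/
def schwartzConvIter (ψ : 𝓢(ℝ, ℂ)) : ℕ → 𝓢(ℝ, ℂ)
  | 0 => ψ
  | n + 1 => SchwartzMap.convolution (ContinuousLinearMap.mul ℂ ℂ) (schwartzConvIter ψ n) ψ

theorem coe_schwartzConvIter (ψ : 𝓢(ℝ, ℂ)) (n : ℕ) :
    ⇑(schwartzConvIter ψ n) = convIter (fun x ↦ ψ x) n := by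
  induction n with
  | zero => rfl
  | succ n ih =>
    ext ξ
    simp only [schwartzConvIter, convIter, SchwartzMap.convolution_apply,
      convolution_eq_swap, conv, ih]
    rfl

theorem fourier_schwartzConvIter (ψ : 𝓢(ℝ, ℂ)) (n : ℕ) (x : ℝ) :
    𝓕 (schwartzConvIter ψ n) x = (𝓕 ψ x) ^ (n + 1) := by
  induction n with
  | zero => simp [schwartzConvIter]
  | succ n ih =>
    rw [schwartzConvIter, SchwartzMap.fourier_convolution, SchwartzMap.pairing_apply_apply, ih]
    simp [pow_succ]

theorem SchwartzMap.integrable_exp_smul (f : 𝓢(ℝ, ℂ)) (ξ : ℝ) :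
    Integrable fun v : ℝ ↦
      Complex.exp (((2 * Real.pi * inner ℝ v ξ : ℝ) : ℂ) * Complex.I) • f v := by
  refine f.integrable.bdd_mul (c := 1) (Continuous.aestronglyMeasurable (by fun_prop)) ?_
  exact .of_forall fun v ↦ (Complex.norm_exp_ofReal_mul_I _).le

/-- If the Fourier transforms of Schwartz functions sum pointwise to that of `g`, with summable
`L¹` norms, then the functions themselves sum pointwise to `g`. -/
theorem SchwartzMap.hasSum_of_hasSum_fourier {T : ℕ → 𝓢(ℝ, ℂ)} {g : 𝓢(ℝ, ℂ)}
    (hT : ∀ x, HasSum (fun n ↦ 𝓕 (T n) x) (𝓕 g x))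
    (hs : Summable fun n ↦ ∫ x, ‖𝓕 (T n) x‖) (ξ : ℝ) :
    HasSum (fun n ↦ T n ξ) (g ξ) := by
  have inv (f : 𝓢(ℝ, ℂ)) : f ξ = ∫ v : ℝ,
      Complex.exp (((2 * Real.pi * inner ℝ v ξ : ℝ) : ℂ) * Complex.I) • 𝓕 f v := by
    conv_lhs => rw [← FourierTransform.fourierInv_fourier_eq (F := 𝓢(ℝ, ℂ)) f]
    rw [SchwartzMap.fourierInv_coe, Real.fourierInv_eq']
  have h := hasSum_integral_of_summable_integral_norm
    (fun n ↦ (𝓕 (T n)).integrable_exp_smul ξ)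
    (by simpa only [norm_smul, Complex.norm_exp_ofReal_mul_I, one_mul] using hs)
  simp_rw [← inv] at h
  convert! h
  rw [inv g]
  exact integral_congr_ae (.of_forall fun v ↦ ((hT v).const_smul _).tsum_eq.symm)

theorem exists_schwartzMap_hasSum_convIter (ψ : 𝓢(ℝ, ℂ)) :
    ∃ g : 𝓢(ℝ, ℂ), ∀ ξ, HasSum (fun n : ℕ ↦ convIter (fun x ↦ ψ x) n ξ /
      ((Nat.factorial (n + 1) : ℂ) * ((2 * Real.pi : ℝ) : ℂ) ^ n)) (g ξ) := by
  set c : ℂ := ((2 * Real.pi : ℝ) : ℂ) with hc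
  have hc0 : c ≠ 0 := by simp [hc, Real.pi_ne_zero]
  obtain ⟨v, hv⟩ := (c⁻¹ • 𝓕 ψ).exists_eq_exp_sub_one
  set T : ℕ → 𝓢(ℝ, ℂ) := fun n ↦ ((Nat.factorial (n + 1) : ℂ) * c ^ n)⁻¹ • schwartzConvIter ψ n
    with hT
  have hFT (n : ℕ) (x : ℝ) :
      𝓕 (T n) x = ((Nat.factorial (n + 1) : ℂ) * c ^ n)⁻¹ * (𝓕 ψ x) ^ (n + 1) := by
    rw [hT, FourierTransform.fourier_smul, smul_apply, fourier_schwartzConvIter,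
      smul_eq_mul]
  refine ⟨𝓕⁻ (c • v), fun ξ ↦ ?_⟩
  have key : HasSum (fun n ↦ T n ξ) (𝓕⁻ (c • v) ξ) := by
    refine SchwartzMap.hasSum_of_hasSum_fourier (fun x ↦ ?_) ?_ ξ
    · rw [FourierTransform.fourier_fourierInv_eq, smul_apply, hv]
      convert! (Complex.hasSum_exp_sub_one ((c⁻¹ • 𝓕 ψ) x)).mul_left c using 2 with n
      rw [hFT, smul_apply, smul_eq_mul]
      have : (Nat.factorial (n + 1) : ℂ) ≠ 0 := by exact_mod_cast Nat.factorial_ne_zero _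
      rw [mul_pow, inv_pow, pow_succ c]
      field_simp
    · set M := SchwartzMap.seminorm ℝ 0 0 (𝓕 ψ)
      have hM : 0 ≤ M := apply_nonneg _ _
      have hint := (𝓕 ψ).integrable (μ := volume)
      refine Summable.of_nonneg_of_le (fun n ↦ integral_nonneg fun x ↦ norm_nonneg _)
        (fun n ↦ ?_) ((Real.summable_pow_div_factorial (M / ‖c‖)).mul_right (∫ x, ‖𝓕 ψ x‖))
      rw [← integral_const_mul]
      refine integral_mono (𝓕 (T n)).integrable.norm (hint.norm.const_mul _) fun x ↦ ?_
      have hx : ‖𝓕 ψ x‖ ≤ M := SchwartzMap.norm_le_seminorm ℝ _ x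
      have hf : (Nat.factorial n : ℝ) ≤ Nat.factorial (n + 1) := by
        exact_mod_cast Nat.factorial_le n.le_succ
      have hc' : 0 < ‖c‖ := norm_pos_iff.2 hc0
      have hn : (0 : ℝ) < Nat.factorial n := by exact_mod_cast Nat.factorial_pos n
      simp only [hFT, norm_mul, norm_inv, norm_pow, Complex.norm_natCast, pow_succ, ← mul_assoc]
      gcongr
      calc ((Nat.factorial (n + 1) : ℝ) * ‖c‖ ^ n)⁻¹ * ‖𝓕 ψ x‖ ^ n
          ≤ ((Nat.factorial n : ℝ) * ‖c‖ ^ n)⁻¹ * M ^ n := by gcongr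
        _ = (M / ‖c‖) ^ n / (Nat.factorial n : ℝ) := by
          rw [div_pow]
          field_simp
  convert! key using 2 with n
  rw [hT, smul_apply, coe_schwartzConvIter, smul_eq_mul, div_eq_inv_mul]

/-- Theorem `preliminaries:convolution:theorem2`: if `ψ` is Schwartz
then `exp₁*[ψ]` and `exp₂*[ψ]` agree almost everywhere with Schwartz functions. -/
theorem stmt_12 (ψ : SchwartzMap ℝ ℂ) :
    (∃ g : SchwartzMap ℝ ℂ, ∀ᵐ ξ : ℝ, g ξ = exp1star (fun x => ψ x) ξ) ∧
    (∃ h : SchwartzMap ℝ ℂ, ∀ᵐ ξ : ℝ, h ξ = exp2star (fun x => ψ x) ξ) := by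
  obtain ⟨g, hg⟩ := exists_schwartzMap_hasSum_convIter ψ
  refine ⟨⟨g, .of_forall fun ξ ↦ (hg ξ).tsum_eq.symm⟩,
    ⟨g - ψ, .of_forall fun ξ ↦ ?_⟩⟩
  have h := hg ξ
  rw [← hasSum_nat_add_iff' 1] at h
  simpa [convIter, exp2star] using h.tsum_eq.symm

end
end

section
/- Suppose C > 0 and μ > 0 are real numbers. Define g₁(ξ) = C·exp(−μ|ξ|) and, for each integer m ≥ 1, g_{m+1}(ξ) = (1/2π)·(g_m * g₁)(ξ). Then for every integer m ≥ 1 and every ξ ∈ ℝ with ξ ≠ 0, g_m(ξ) = 2·√(μC)·(C|ξ|/(2π))^{m−1/2}·K_{m−1/2}(μ|ξ|)/Γ(m), where K_ν denotes the modified Bessel function of the second kind. -/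
open MeasureTheory Filter

noncomputable section

/-- The reverse Bessel polynomials, `θ₀ = 1`, `θ₁ = X + 1`,
`θ_{n+2} = X² θ_n + (2n+3) θ_{n+1}`. -/
def reverseBessel : ℕ → Polynomial ℝ
  | 0 => 1
  | 1 => Polynomial.X + 1
  | n + 2 => Polynomial.X ^ 2 * reverseBessel n
      + Polynomial.C (2 * (n : ℝ) + 3) * reverseBessel (n + 1)

/-- The Matérn-type function `θ_n(x) exp(-x)`. -/
def matern (n : ℕ) (x : ℝ) : ℝ := (reverseBessel n).eval x * Real.exp (-x)

theorem matern_zero (x : ℝ) : matern 0 x = Real.exp (-x) := by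
  simp [matern, reverseBessel]

theorem matern_one (x : ℝ) : matern 1 x = (x + 1) * Real.exp (-x) := by
  simp [matern, reverseBessel]

theorem matern_add_two (n : ℕ) (x : ℝ) :
    matern (n + 2) x = x ^ 2 * matern n x + (2 * n + 3) * matern (n + 1) x := by
  simp only [matern, reverseBessel, Polynomial.eval_add, Polynomial.eval_mul, Polynomial.eval_pow,
    Polynomial.eval_X, Polynomial.eval_C]
  ring

theorem hasDerivAt_matern_zero (x : ℝ) : HasDerivAt (matern 0) (-matern 0 x) x := by
  have h := (hasDerivAt_neg x).exp
  rw [funext matern_zero]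
  convert! h using 1
  ring

theorem hasDerivAt_matern_one (x : ℝ) : HasDerivAt (matern 1) (-(x * matern 0 x)) x := by
  have h := ((hasDerivAt_id x).add_const 1).mul (hasDerivAt_neg x).exp
  rw [funext matern_one, matern_zero]
  convert! h using 1
  simp only [id]
  ring

theorem hasDerivAt_matern_succ (n : ℕ) (x : ℝ) :
    HasDerivAt (matern (n + 1)) (-(x * matern n x)) x := by
  induction n using Nat.twoStepInduction with
  | zero => exact hasDerivAt_matern_one x
  | one =>
    have h := ((hasDerivAt_pow 2 x).mul (hasDerivAt_matern_zero x)).add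
      ((hasDerivAt_matern_one x).const_mul (2 * ((0 : ℕ) : ℝ) + 3))
    rw [show matern (1 + 1) = _ from funext (matern_add_two 0)]
    convert! h using 1
    simp only [matern_zero, matern_one]
    push_cast
    ring
  | more n ih₀ ih₁ =>
    have h := ((hasDerivAt_pow 2 x).mul ih₀).add (ih₁.const_mul (2 * ((n + 1 : ℕ) : ℝ) + 3))
    rw [show matern (n + 2 + 1) = _ from funext (matern_add_two (n + 1))]
    convert! h using 1
    simp only [matern_add_two n]
    push_cast
    ring

theorem continuous_matern (n : ℕ) : Continuous (matern n) := by
  unfold matern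
  fun_prop

theorem tendsto_mul_matern (p : Polynomial ℝ) (n : ℕ) :
    Tendsto (fun x => p.eval x * matern n x) atTop (nhds 0) := by
  refine (Polynomial.tendsto_div_exp_atTop (p * reverseBessel n)).congr fun x => ?_
  rw [matern, Real.exp_neg, Polynomial.eval_mul]
  ring

theorem exists_forall_abs_le_of_tendsto {f : ℝ → ℝ} (hf : Continuous f)
    (h : Tendsto f atTop (nhds 0)) : ∃ M, ∀ x, 0 ≤ x → |f x| ≤ M := by
  obtain ⟨b, hb⟩ := eventually_atTop.1
    (h.abs.eventually_le_const (show |(0 : ℝ)| < 1 by simp))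
  obtain ⟨M, hM⟩ := (isCompact_Icc (a := (0 : ℝ)) (b := b)).exists_bound_of_continuousOn
    hf.continuousOn
  refine ⟨max M 1, fun x hx => ?_⟩
  rcases le_total x b with hxb | hxb
  · exact (hM x ⟨hx, hxb⟩).trans (le_max_left _ _)
  · exact (hb x hxb).trans (le_max_right _ _)

theorem hasDerivAt_comp_abs {q q' : ℝ → ℝ} (hq : ∀ x, HasDerivAt q (x * q' x) x) (x : ℝ) :
    HasDerivAt (fun y => q |y|) (x * q' |x|) x := by
  rcases lt_trichotomy x 0 with hx | rfl | hx
  · have h := (hq |x|).comp x (hasDerivAt_abs_neg hx)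
    convert! h using 1
    rw [abs_of_neg hx]
    ring
  · have h := hq 0
    rw [zero_mul, hasDerivAt_iff_isLittleO_nhds_zero] at h ⊢
    have habs : Tendsto (fun y : ℝ => |y|) (nhds 0) (nhds 0) := by
      simpa using (continuous_abs.tendsto (0 : ℝ))
    simpa [Function.comp_def] using (h.comp_tendsto habs).trans_isBigO
      (Asymptotics.isBigO_refl (fun y : ℝ => y) _).norm_left
  · have h := (hq |x|).comp x (hasDerivAt_abs_pos hx)
    convert! h using 1
    rw [abs_of_pos hx]
    ring

theorem hasDerivAt_id_mul_comp_abs {q q' : ℝ → ℝ} (hq : ∀ x, HasDerivAt q (q' x) x) (x : ℝ) :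
    HasDerivAt (fun y => y * q |y|) (q |x| + |x| * q' |x|) x := by
  rcases lt_trichotomy x 0 with hx | rfl | hx
  · have h := (hasDerivAt_id x).mul ((hq |x|).comp x (hasDerivAt_abs_neg hx))
    convert! h using 1
    simp only [id, Function.comp_apply, abs_of_neg hx]
    ring
  · have hc : Continuous q := continuous_iff_continuousAt.2 fun y => (hq y).continuousAt
    rw [hasDerivAt_iff_tendsto_slope_zero]
    have h : Tendsto (fun y : ℝ => q |y|) (nhdsWithin 0 {0}ᶜ) (nhds (q |0|)) :=
      ((hc.comp continuous_abs).tendsto 0).mono_left nhdsWithin_le_nhds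
    simp only [abs_zero, zero_mul, add_zero] at h ⊢
    refine h.congr' ?_
    filter_upwards [self_mem_nhdsWithin] with y hy
    have hy : y ≠ 0 := hy
    simp [hy]
  · have h := (hasDerivAt_id x).mul ((hq |x|).comp x (hasDerivAt_abs_pos hx))
    convert! h using 1
    simp only [id, Function.comp_apply, abs_of_pos hx]
    ring

theorem hasDerivAt_matern_succ_abs (n : ℕ) (x : ℝ) :
    HasDerivAt (fun y => matern (n + 1) |y|) (-(x * matern n |x|)) x := by
  have h := hasDerivAt_comp_abs (q := matern (n + 1)) (q' := fun y => -matern n y)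
    (fun y => by simpa using hasDerivAt_matern_succ n y) x
  simpa using h

/-- The second-order equation `H'' - H = -2(n+1) θ_n(|x|) exp(-|x|)`, where
`H(x) = θ_{n+1}(|x|) exp(-|x|)` has derivative `-x θ_n(|x|) exp(-|x|)`. -/
theorem hasDerivAt_neg_mul_matern_abs (n : ℕ) (x : ℝ) :
    HasDerivAt (fun y => -(y * matern n |y|))
      (matern (n + 1) |x| - 2 * (n + 1) * matern n |x|) x := by
  cases n with
  | zero =>
    convert! (hasDerivAt_id_mul_comp_abs hasDerivAt_matern_zero x).neg using 1
    simp only [zero_add, matern_zero, matern_one]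
    push_cast
    ring
  | succ n =>
    convert! (hasDerivAt_id_mul_comp_abs (hasDerivAt_matern_succ n) x).neg using 1
    rw [matern_add_two]
    push_cast
    ring

theorem exists_abs_matern_abs_le (n : ℕ) : ∃ M, ∀ x, |matern n (|x|)| ≤ M := by
  obtain ⟨M, hM⟩ := exists_forall_abs_le_of_tendsto (continuous_matern n)
    (by simpa using tendsto_mul_matern 1 n)
  exact ⟨M, fun x => hM _ (abs_nonneg x)⟩

theorem exists_abs_mul_matern_abs_le (n : ℕ) : ∃ M, ∀ x, |x * matern n (|x|)| ≤ M := by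
  obtain ⟨M, hM⟩ := exists_forall_abs_le_of_tendsto (f := fun x => x * matern n x)
    (continuous_id.mul (continuous_matern n)) (by simpa using tendsto_mul_matern Polynomial.X n)
  exact ⟨M, fun x => by simpa [abs_mul] using hM _ (abs_nonneg x)⟩

theorem integrableOn_matern_abs_mul_exp (n : ℕ) (ξ : ℝ) :
    IntegrableOn (fun η => matern n |ξ - η| * Real.exp (-η)) (Set.Ioi 0) := by
  obtain ⟨M, hM⟩ := exists_abs_matern_abs_le n
  exact (integrableOn_exp_neg_Ioi 0).bdd_mul
    (((continuous_matern n).comp (by fun_prop)).aestronglyMeasurable)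
    (Eventually.of_forall fun η => hM (ξ - η))

theorem integral_Ioi_matern_abs_mul_exp (n : ℕ) (ξ : ℝ) :
    2 * ((n : ℝ) + 1) * ∫ η in Set.Ioi (0 : ℝ), matern n |ξ - η| * Real.exp (-η)
      = matern (n + 1) |ξ| + ξ * matern n |ξ| := by
  obtain ⟨M₀, hM₀⟩ := exists_abs_matern_abs_le (n + 1)
  obtain ⟨M₁, hM₁⟩ := exists_abs_mul_matern_abs_le n
  have hderiv : ∀ η : ℝ, HasDerivAt
      (fun η => (-matern (n + 1) |ξ - η| - (ξ - η) * matern n |ξ - η|) * Real.exp (-η))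
      (2 * ((n : ℝ) + 1) * (matern n |ξ - η| * Real.exp (-η))) η := by
    intro η
    have hsub : HasDerivAt (fun η => ξ - η) (-1) η := by
      simpa using (hasDerivAt_id η).const_sub ξ
    have h := ((((hasDerivAt_matern_succ_abs n (ξ - η)).comp η hsub).neg).add
      ((hasDerivAt_neg_mul_matern_abs n (ξ - η)).comp η hsub)).mul (hasDerivAt_neg η).exp
    convert! h using 1
    simp only [Pi.add_apply, Pi.neg_apply, Function.comp_apply]
    ring
  have hlim : Tendsto
      (fun η => (-matern (n + 1) |ξ - η| - (ξ - η) * matern n |ξ - η|) * Real.exp (-η))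
      atTop (nhds 0) := by
    refine squeeze_zero_norm (a := fun η => (M₀ + M₁) * Real.exp (-η)) (fun η => ?_) ?_
    · rw [norm_mul, Real.norm_eq_abs, Real.norm_eq_abs, Real.abs_exp]
      gcongr
      have h₀ := abs_le.1 (hM₀ (ξ - η))
      have h₁ := abs_le.1 (hM₁ (ξ - η))
      exact abs_le.2 ⟨by linarith, by linarith⟩
    · simpa using (Real.tendsto_exp_neg_atTop_nhds_zero.const_mul (M₀ + M₁))
  have h := integral_Ioi_of_hasDerivAt_of_tendsto (hderiv 0).continuousAt.continuousWithinAt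
    (fun η _ => hderiv η) ((integrableOn_matern_abs_mul_exp n ξ).const_mul _) hlim
  rw [integral_const_mul] at h
  rw [h]
  simp
  ring

theorem integral_matern_abs_mul_exp_abs (n : ℕ) (ξ : ℝ) :
    ∫ η : ℝ, matern n |ξ - η| * Real.exp (-|η|) = matern (n + 1) |ξ| / (n + 1) := by
  have hright : Set.EqOn (fun η => matern n |ξ - η| * Real.exp (-|η|))
      (fun η => matern n |ξ - η| * Real.exp (-η)) (Set.Ioi 0) := fun η hη => by
    simp only [abs_of_pos (Set.mem_Ioi.1 hη)]
  have hleft : Set.EqOn (fun η => matern n |ξ - -η| * Real.exp (-|(-η)|))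
      (fun η => matern n |(-ξ) - η| * Real.exp (-η)) (Set.Ioi 0) := fun η hη => by
    simp only [abs_neg, abs_of_pos (Set.mem_Ioi.1 hη)]
    rw [← abs_neg (-ξ - η), neg_sub, sub_neg_eq_add, sub_neg_eq_add, add_comm]
  have hintR := (integrableOn_matern_abs_mul_exp n ξ).congr_fun hright.symm measurableSet_Ioi
  have hintL := (integrableOn_matern_abs_mul_exp n (-ξ)).congr_fun hleft.symm measurableSet_Ioi
  have hintL' : IntegrableOn (fun η => matern n |ξ - η| * Real.exp (-|η|)) (Set.Iic 0) := by
    rw [integrableOn_Iic_iff_integrableOn_Iio]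
    have := hintL.comp_neg
    simpa using this
  rw [← intervalIntegral.integral_Iic_add_Ioi hintL' hintR]
  have hneg := integral_comp_neg_Ioi 0 (fun η => matern n |ξ - η| * Real.exp (-|η|))
  rw [neg_zero] at hneg
  rw [← hneg, setIntegral_congr_fun measurableSet_Ioi hright,
    setIntegral_congr_fun measurableSet_Ioi hleft, eq_div_iff (by positivity)]
  have h₁ := integral_Ioi_matern_abs_mul_exp n ξ
  have h₂ := integral_Ioi_matern_abs_mul_exp n (-ξ)
  rw [abs_neg] at h₂
  linarith

theorem integral_matern_mul_abs_mul_exp {μ : ℝ} (hμ : 0 < μ) (n : ℕ) (ξ : ℝ) :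
    ∫ η : ℝ, matern n (μ * |ξ - η|) * Real.exp (-μ * |η|)
      = matern (n + 1) (μ * |ξ|) / (μ * (n + 1)) := by
  have h := Measure.integral_comp_mul_left
    (fun y => matern n |μ * ξ - y| * Real.exp (-|y|)) μ
  have habs : ∀ y, μ * |y| = |μ * y| := fun y => by rw [abs_mul, abs_of_pos hμ]
  rw [integral_matern_abs_mul_exp_abs] at h
  simp only [neg_mul, habs, mul_sub]
  rw [h, abs_of_pos (inv_pos.2 hμ), smul_eq_mul]
  field_simp

theorem iterated_conv_eq_matern {C μ : ℝ} (hμ : 0 < μ) {g : ℕ → ℝ → ℝ}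
    (hg0 : ∀ ξ : ℝ, g 0 ξ = C * Real.exp (-μ * |ξ|))
    (hgsucc : ∀ (n : ℕ) (ξ : ℝ),
      g (n + 1) ξ = (1 / (2 * Real.pi)) * ∫ η : ℝ, g n (ξ - η) * g 0 η) (n : ℕ) (ξ : ℝ) :
    g n ξ = C * (C / (2 * Real.pi * μ)) ^ n / n.factorial * matern n (μ * |ξ|) := by
  induction n generalizing ξ with
  | zero => simp [hg0, matern_zero]
  | succ n ih =>
    simp only [hgsucc, ih, hg0]
    have hpi := Real.pi_pos
    calc _ = (1 / (2 * Real.pi)) * ∫ η : ℝ,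
          (C * (C / (2 * Real.pi * μ)) ^ n / n.factorial * C) *
            (matern n (μ * |ξ - η|) * Real.exp (-μ * |η|)) := by
          congr 2 with η
          ring
      _ = _ := by
          rw [integral_const_mul, integral_matern_mul_abs_mul_exp hμ, Nat.factorial_succ]
          push_cast
          rw [pow_succ]
          field_simp

theorem exists_exp_neg_mul_cosh_mul_exp_le {t : ℝ} (ht : 0 < t) (a : ℝ) :
    ∃ M, ∀ s, 0 ≤ s → Real.exp (-t * Real.cosh s) * Real.exp (a * s) ≤ M * Real.exp (-s) := by
  obtain ⟨k, hk⟩ := exists_nat_ge (a + 1)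
  refine ⟨k.factorial * (2 / t) ^ k, fun s hs => ?_⟩
  have hexp := Real.exp_pos s
  have h₁ : t / 2 * Real.exp s ≤ t * Real.cosh s := by
    rw [Real.cosh_eq]
    nlinarith [Real.exp_pos (-s)]
  have h₂ : (t / 2 * Real.exp s) ^ k / k.factorial ≤ Real.exp (t * Real.cosh s) :=
    (Real.pow_div_factorial_le_exp _ (by positivity) k).trans (Real.exp_le_exp.2 h₁)
  have h₃ : Real.exp ((a + 1) * s) ≤ Real.exp s ^ k := by
    rw [← Real.exp_nat_mul]
    exact Real.exp_le_exp.2 (by nlinarith)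
  have h₄ : Real.exp ((a + 1) * s) ≤
      k.factorial * (2 / t) ^ k * Real.exp (t * Real.cosh s) := by
    refine h₃.trans ?_
    calc Real.exp s ^ k
        = k.factorial * (2 / t) ^ k * ((t / 2 * Real.exp s) ^ k / k.factorial) := by
          rw [mul_assoc, mul_div_assoc', ← mul_pow, ← mul_assoc, div_mul_div_cancel₀ ht.ne',
            div_self two_ne_zero, one_mul]
          field_simp
      _ ≤ _ := by gcongr
  rw [neg_mul, Real.exp_neg, Real.exp_neg, inv_mul_le_iff₀ (Real.exp_pos _), ← div_eq_mul_inv,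
    mul_div_assoc', le_div_iff₀ hexp, ← Real.exp_add]
  convert! h₄ using 1
  · ring_nf
  · ring

theorem integrableOn_exp_neg_mul_cosh_mul_exp {t : ℝ} (ht : 0 < t) (a : ℝ) :
    IntegrableOn (fun s => Real.exp (-t * Real.cosh s) * Real.exp (a * s)) (Set.Ioi 0) := by
  obtain ⟨M, hM⟩ := exists_exp_neg_mul_cosh_mul_exp_le ht a
  refine Integrable.mono' ((integrableOn_exp_neg_Ioi 0).const_mul M)
    (by fun_prop) ?_
  filter_upwards [ae_restrict_mem measurableSet_Ioi] with s hs
  rw [Real.norm_of_nonneg (by positivity)]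
  exact hM s (le_of_lt hs)

theorem tendsto_exp_neg_mul_cosh_mul_exp {t : ℝ} (ht : 0 < t) (a : ℝ) :
    Tendsto (fun s => Real.exp (-t * Real.cosh s) * Real.exp (a * s)) atTop (nhds 0) := by
  obtain ⟨M, hM⟩ := exists_exp_neg_mul_cosh_mul_exp_le ht a
  refine squeeze_zero' (Eventually.of_forall fun s => by positivity)
    ((eventually_ge_atTop 0).mono hM) ?_
  simpa using Real.tendsto_exp_neg_atTop_nhds_zero.const_mul M

theorem integrableOn_besselK {t : ℝ} (ht : 0 < t) (ν : ℝ) :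
    IntegrableOn (fun s => Real.exp (-t * Real.cosh s) * Real.cosh (ν * s)) (Set.Ioi 0) := by
  have h := ((integrableOn_exp_neg_mul_cosh_mul_exp ht ν).add
    (integrableOn_exp_neg_mul_cosh_mul_exp ht (-ν))).div_const 2
  refine h.congr (Eventually.of_forall fun s => ?_)
  simp only [Pi.add_apply, Real.cosh_eq (ν * s), neg_mul]
  ring

theorem besselK_recurrence {t : ℝ} (ht : 0 < t) (ν : ℝ) :
    besselK (ν + 1) t = besselK (ν - 1) t + 2 * ν / t * besselK ν t := by
  have hderiv : ∀ s : ℝ, HasDerivAt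
      (fun s => Real.exp (-t * Real.cosh s) * Real.sinh (ν * s))
      (ν * (Real.exp (-t * Real.cosh s) * Real.cosh (ν * s))
        - t / 2 * (Real.exp (-t * Real.cosh s) * Real.cosh ((ν + 1) * s)
          - Real.exp (-t * Real.cosh s) * Real.cosh ((ν - 1) * s))) s := by
    intro s
    have h := (((Real.hasDerivAt_cosh s).const_mul (-t)).exp).mul
      (((hasDerivAt_id s).const_mul ν).sinh)
    convert! h using 1
    simp only [id, add_mul, sub_mul, one_mul, Real.cosh_add, Real.cosh_sub]
    ring
  have hlim : Tendsto (fun s => Real.exp (-t * Real.cosh s) * Real.sinh (ν * s))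
      atTop (nhds 0) := by
    have h := ((tendsto_exp_neg_mul_cosh_mul_exp ht ν).sub
      (tendsto_exp_neg_mul_cosh_mul_exp ht (-ν))).div_const 2
    rw [sub_zero, zero_div] at h
    refine h.congr fun s => ?_
    simp only [Real.sinh_eq (ν * s), neg_mul]
    ring
  have hi := integrableOn_besselK ht ν
  have hi₁ := integrableOn_besselK ht (ν + 1)
  have hi₂ := integrableOn_besselK ht (ν - 1)
  have hi₃ : IntegrableOn (fun s => Real.exp (-t * Real.cosh s) * Real.cosh ((ν + 1) * s)
      - Real.exp (-t * Real.cosh s) * Real.cosh ((ν - 1) * s)) (Set.Ioi 0) := hi₁.sub hi₂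
  have h := integral_Ioi_of_hasDerivAt_of_tendsto (hderiv 0).continuousAt.continuousWithinAt
    (fun s _ => hderiv s) ((hi.const_mul ν).sub (hi₃.const_mul (t / 2))) hlim
  rw [integral_sub (hi.const_mul ν) (hi₃.const_mul (t / 2)), integral_const_mul,
    integral_const_mul, integral_sub hi₁ hi₂] at h
  simp only [mul_zero, Real.sinh_zero, sub_zero] at h
  change ν * besselK ν t - t / 2 * (besselK (ν + 1) t - besselK (ν - 1) t) = 0 at h
  field_simp
  linarith

theorem besselK_neg (ν t : ℝ) : besselK (-ν) t = besselK ν t := by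
  simp [besselK]

theorem besselK_one_half {t : ℝ} (ht : 0 < t) :
    besselK (1 / 2) t = √(Real.pi / (2 * t)) * Real.exp (-t) := by
  have hpt : ∀ s : ℝ, ((fun u : ℝ => 2 * Real.exp (-t) * Real.exp (-(2 * t) * u ^ 2)) ∘
      fun s => Real.sinh (s / 2)) s * (Real.cosh (s / 2) * (1 / 2))
      = Real.exp (-t * Real.cosh s) * Real.cosh (1 / 2 * s) := by
    intro s
    have hc : Real.cosh s = 1 + 2 * Real.sinh (s / 2) ^ 2 := by
      have h := Real.cosh_two_mul (s / 2)
      rw [mul_div_cancel₀ s two_ne_zero, Real.cosh_sq] at h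
      linarith
    have he : Real.exp (-t * Real.cosh s)
        = Real.exp (-t) * Real.exp (-(2 * t) * Real.sinh (s / 2) ^ 2) := by
      rw [hc, ← Real.exp_add]
      ring_nf
    rw [he, Function.comp_apply, one_div_mul_eq_div]
    ring
  have htend : Tendsto (fun s => Real.sinh (s / 2)) atTop atTop :=
    (Real.sinhOrderIso.tendsto_atTop).comp (tendsto_id.atTop_div_const two_pos)
  have hint : Integrable (fun u : ℝ => 2 * Real.exp (-t) * Real.exp (-(2 * t) * u ^ 2)) :=
    (integrable_exp_neg_mul_sq (by positivity : 0 < 2 * t)).const_mul _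
  have h := integral_comp_mul_deriv_Ioi (a := 0) (f := fun s => Real.sinh (s / 2))
    (f' := fun s => Real.cosh (s / 2) * (1 / 2))
    (g := fun u => 2 * Real.exp (-t) * Real.exp (-(2 * t) * u ^ 2))
    (by fun_prop) htend
    (fun s _ => (((hasDerivAt_id s).div_const 2).sinh).hasDerivWithinAt)
    (by fun_prop) hint.integrableOn
    (by
      rw [integrableOn_Ici_iff_integrableOn_Ioi]
      simpa only [hpt] using integrableOn_besselK ht (1 / 2))
  simp only [hpt] at h
  rw [besselK, h, zero_div, Real.sinh_zero, integral_const_mul, integral_gaussian_Ioi]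
  ring

theorem besselK_nat_add_half {t : ℝ} (ht : 0 < t) (n : ℕ) :
    besselK (n + 1 / 2) t = √(Real.pi / (2 * t)) / t ^ n * matern n t := by
  induction n using Nat.twoStepInduction with
  | zero => simpa [matern_zero] using besselK_one_half ht
  | one =>
    have h := besselK_recurrence ht (1 / 2)
    rw [show (1 / 2 - 1 : ℝ) = -(1 / 2) by norm_num, besselK_neg, besselK_one_half ht] at h
    rw [Nat.cast_one, add_comm, h, matern_one]
    field_simp
  | more n ih₀ ih₁ =>
    have h := besselK_recurrence ht (n + 1 + 1 / 2)
    rw [show (n + 1 + 1 / 2 - 1 : ℝ) = n + 1 / 2 by ring,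
      show (n + 1 + 1 / 2 : ℝ) = ((n + 1 : ℕ) : ℝ) + 1 / 2 by push_cast; ring, ih₀, ih₁] at h
    rw [show ((n + 2 : ℕ) : ℝ) + 1 / 2 = ((n + 1 : ℕ) : ℝ) + 1 / 2 + 1 by push_cast; ring, h,
      matern_add_two]
    push_cast
    field_simp
    ring

/-- Formula `spectrum:S2:convolution_product`: closed form for the
iterated convolutions of `C·exp(−μ|ξ|)` in terms of modified Bessel functions. -/
theorem stmt_16
    (C μ : ℝ) (hC : 0 < C) (hμ : 0 < μ)
    (g : ℕ → ℝ → ℝ)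
    (hg0 : ∀ ξ : ℝ, g 0 ξ = C * Real.exp (-μ * |ξ|))
    (hgsucc : ∀ (n : ℕ) (ξ : ℝ),
      g (n + 1) ξ = (1 / (2 * Real.pi)) * ∫ η : ℝ, g n (ξ - η) * g 0 η) :
    ∀ (n : ℕ) (ξ : ℝ), ξ ≠ 0 →
      g n ξ = 2 * Real.sqrt (μ * C) * (C * |ξ| / (2 * Real.pi)) ^ ((n : ℝ) + 1 / 2)
        * besselK ((n : ℝ) + 1 / 2) (μ * |ξ|) / Real.Gamma ((n : ℝ) + 1) := by
  intro n ξ hξ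
  have hx : 0 < |ξ| := abs_pos.2 hξ
  have hpi := Real.pi_pos
  have hsqrt : √(μ * C) * (√(C * |ξ| / (2 * Real.pi)) * √(Real.pi / (2 * (μ * |ξ|)))) = C / 2 := by
    rw [← Real.sqrt_mul (by positivity), ← Real.sqrt_mul (by positivity),
      show μ * C * (C * |ξ| / (2 * Real.pi) * (Real.pi / (2 * (μ * |ξ|)))) = (C / 2) ^ 2 by
        field_simp,
      Real.sqrt_sq (by positivity)]
  rw [iterated_conv_eq_matern hμ hg0 hgsucc, besselK_nat_add_half (by positivity),
    Real.Gamma_nat_eq_factorial, Real.rpow_add (by positivity), Real.rpow_natCast,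
    ← Real.sqrt_eq_rpow]
  calc _ = 2 * (C / 2) * ((C * |ξ| / (2 * Real.pi)) ^ n / (μ * |ξ|) ^ n)
        * matern n (μ * |ξ|) / n.factorial := by
        rw [← div_pow, show C * |ξ| / (2 * Real.pi) / (μ * |ξ|) = C / (2 * Real.pi * μ) by
          field_simp]
        ring
    _ = _ := by
        rw [← hsqrt]
        ring

end
end
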